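/- arXiv:1601.06606 — 4 statements merged into one kernel-verified Lean document; each statement's English description precedes it below -/
import Mathlib

section
/- Let γ ∈ (0,1) and let μ be the probability measure on [0,1] with density p(x) = C_p (x − 1/2)^{γ−1} 1_{(1/2, 3/4)}(x), where C_p = γ·4^γ is the normalizing constant. Let θ have law μ and let X̄_n have law P[X̄_n = k/n] = C(n,k) ∫_0^1 t^k (1-t)^{n-k} μ(dt). Then there exists a constant C > 0 such that for all n ≥ 1, d_W(X̄_n, θ) ≥ C / n^{(1+γ)/2}. -/
open MeasureTheory ProbabilityTheory Set

/-- Wasserstein distance between two laws on ℝ (dual formulation):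
`d_W(μ,ν) = sup over 1-Lipschitz φ of |∫φ dμ - ∫φ dν|`. -/
noncomputable def dW (μ ν : Measure ℝ) : ℝ :=
  ⨆ φ : {f : ℝ → ℝ // LipschitzWith 1 f}, |(∫ x, φ.1 x ∂μ) - ∫ x, φ.1 x ∂ν|

/-- Law of the empirical mean `X̄ₙ` of the first `n` terms of an exchangeable 0-1 sequence
with de Finetti mixing measure `μ` : `P[X̄ₙ = k/n] = C(n,k) ∫ t^k (1-t)^(n-k) dμ(t)`. -/
noncomputable def barLaw (μ : Measure ℝ) (n : ℕ) : Measure ℝ :=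
  ∑ k ∈ Finset.range (n + 1),
    (ENNReal.ofReal ((n.choose k : ℝ) * ∫ t, t ^ k * (1 - t) ^ (n - k) ∂μ)) •
      Measure.dirac ((k : ℝ) / n)

/-- Expectation of `f` under the binomial law with parameters `n` and `t`. -/
noncomputable def binomialMean (n : ℕ) (t : ℝ) (f : ℕ → ℝ) : ℝ :=
  ∑ k ∈ Finset.range (n + 1), (n.choose k : ℝ) * (t ^ k * (1 - t) ^ (n - k)) * f k

lemma binomialMean_succ (n : ℕ) (t : ℝ) (f : ℕ → ℝ) :
    binomialMean (n + 1) t f =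
      (1 - t) * binomialMean n t f + t * binomialMean n t (fun k => f (k + 1)) := by
  have h : (1 - t) * binomialMean n t f =
      ∑ k ∈ Finset.range (n + 1 + 1),
        (n.choose k : ℝ) * (t ^ k * (1 - t) ^ (n + 1 - k)) * f k := by
    rw [Finset.sum_range_succ, Nat.choose_succ_self, binomialMean, Finset.mul_sum]
    simp only [Nat.cast_zero, zero_mul, add_zero]
    refine Finset.sum_congr rfl fun k hk => ?_
    rw [Nat.succ_sub (Nat.lt_succ_iff.mp (Finset.mem_range.mp hk)), pow_succ]
    ring
  rw [h, binomialMean, Finset.sum_range_succ', Finset.sum_range_succ' _ (n + 1), binomialMean,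
    Finset.mul_sum, add_right_comm, ← Finset.sum_add_distrib]
  congr 1
  · refine Finset.sum_congr rfl fun k _ => ?_
    rw [Nat.choose_succ_succ, Nat.add_sub_add_right]
    push_cast
    ring
  · simp

lemma binomialMean_add (n : ℕ) (t : ℝ) (f g : ℕ → ℝ) :
    binomialMean n t (fun k => f k + g k) = binomialMean n t f + binomialMean n t g := by
  simp only [binomialMean, mul_add, Finset.sum_add_distrib]

lemma binomialMean_const_mul (n : ℕ) (t c : ℝ) (f : ℕ → ℝ) :
    binomialMean n t (fun k => c * f k) = c * binomialMean n t f := by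
  simp only [binomialMean, Finset.mul_sum]
  exact Finset.sum_congr rfl fun k _ => by ring

lemma binomialMean_mono {n : ℕ} {t : ℝ} (h0 : 0 ≤ t) (h1 : t ≤ 1) {f g : ℕ → ℝ}
    (h : ∀ k ≤ n, f k ≤ g k) : binomialMean n t f ≤ binomialMean n t g := by
  refine Finset.sum_le_sum fun k hk => mul_le_mul_of_nonneg_left
    (h k (Nat.lt_succ_iff.mp (Finset.mem_range.mp hk))) ?_
  have := sub_nonneg.mpr h1
  positivity

lemma binomialMean_one (n : ℕ) (t : ℝ) : binomialMean n t (fun _ => 1) = 1 := by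
  induction n with
  | zero => simp [binomialMean]
  | succ n ih => rw [binomialMean_succ, ih]; ring

/-- The moments up to order four of a sum of `n` independent signs of mean `2 * t - 1`. -/
lemma binomialMean_moments (n : ℕ) (t : ℝ) :
    binomialMean n t (fun k => 2 * (k : ℝ) - n) = n * (2 * t - 1) ∧
    binomialMean n t (fun k => (2 * (k : ℝ) - n) ^ 2) =
      n + n * (n - 1) * (2 * t - 1) ^ 2 ∧
    binomialMean n t (fun k => (2 * (k : ℝ) - n) ^ 3) =
      n * (3 * n - 2) * (2 * t - 1) + n * (n - 1) * (n - 2) * (2 * t - 1) ^ 3 ∧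
    binomialMean n t (fun k => (2 * (k : ℝ) - n) ^ 4) =
      n * (3 * n - 2) + n * (n - 1) * (6 * n - 8) * (2 * t - 1) ^ 2 +
        n * (n - 1) * (n - 2) * (n - 3) * (2 * t - 1) ^ 4 := by
  induction n with
  | zero => simp [binomialMean]
  | succ n ih =>
    obtain ⟨h1, h2, h3, h4⟩ := ih
    have key (f : ℕ → ℝ) (c0 c1 c2 c3 c4 : ℝ) (hf : ∀ k : ℕ, f k = c0 * 1 +
        (c1 * (2 * (k : ℝ) - n) + (c2 * (2 * (k : ℝ) - n) ^ 2 +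
        (c3 * (2 * (k : ℝ) - n) ^ 3 + c4 * (2 * (k : ℝ) - n) ^ 4)))) :
        binomialMean n t f = c0 * 1 + (c1 * (n * (2 * t - 1)) +
          (c2 * (n + n * (n - 1) * (2 * t - 1) ^ 2) +
          (c3 * (n * (3 * n - 2) * (2 * t - 1) + n * (n - 1) * (n - 2) * (2 * t - 1) ^ 3) +
          c4 * (n * (3 * n - 2) + n * (n - 1) * (6 * n - 8) * (2 * t - 1) ^ 2 +
            n * (n - 1) * (n - 2) * (n - 3) * (2 * t - 1) ^ 4)))) := by
      rw [funext hf, binomialMean_add, binomialMean_add, binomialMean_add, binomialMean_add,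
        binomialMean_const_mul, binomialMean_const_mul, binomialMean_const_mul,
        binomialMean_const_mul, binomialMean_const_mul, binomialMean_one, h1, h2, h3, h4]
    refine ⟨?_, ?_, ?_, ?_⟩ <;> rw [binomialMean_succ]
    · rw [key _ (-1) 1 0 0 0 fun k => by push_cast; ring,
        key _ 1 1 0 0 0 fun k => by push_cast; ring]
      push_cast
      ring
    · rw [key _ 1 (-2) 1 0 0 fun k => by push_cast; ring,
        key _ 1 2 1 0 0 fun k => by push_cast; ring]
      push_cast
      ring
    · rw [key _ (-1) 3 (-3) 1 0 fun k => by push_cast; ring,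
        key _ 1 3 3 1 0 fun k => by push_cast; ring]
      push_cast
      ring
    · rw [key _ 1 (-4) 6 (-4) 1 fun k => by push_cast; ring,
        key _ 1 4 6 4 1 fun k => by push_cast; ring]
      push_cast
      ring

lemma sub_add_le_posPart {s : ℝ} (hs : 0 < s) (z : ℝ) :
    (z + z ^ 2 / s - z ^ 4 / s ^ 3) / 2 ≤ max z 0 := by
  have hu : (|z| / s) ^ 2 - (|z| / s) ^ 4 ≤ |z| / s := by
    have h0 : 0 ≤ |z| / s := by positivity
    rcases le_total (|z| / s) 1 with h | h
    · nlinarith [pow_nonneg h0 4]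
    · nlinarith [pow_le_pow_right₀ h (show 2 ≤ 4 by norm_num)]
  have h : z ^ 2 / s - z ^ 4 / s ^ 3 ≤ |z| := by
    have := mul_le_mul_of_nonneg_left hu hs.le
    rw [div_pow, div_pow, sq_abs, Even.pow_abs (by decide : Even 4)] at this
    field_simp at this ⊢
    linarith
  rcases le_total z 0 with hz | hz
  · rw [max_eq_right hz]
    rw [abs_of_nonpos hz] at h
    linarith
  · rw [max_eq_left hz]
    rw [abs_of_nonneg hz] at h
    linarith

lemma le_binomialMean_posPart {n : ℕ} (hn : 1 ≤ n) {t : ℝ} (ht : 1 / 2 ≤ t)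
    (ht' : t ≤ 1 / 2 + 1 / (64 * √n)) :
    1 / (64 * √n) ≤ binomialMean n t (fun k => max (1 / 2 - (k : ℝ) / n) 0) := by
  have hn1 : (1 : ℝ) ≤ n := by exact_mod_cast hn
  obtain ⟨r, hr1, hr⟩ : ∃ r : ℝ, 1 ≤ r ∧ r = √n := ⟨√n, Real.one_le_sqrt.mpr hn1, rfl⟩
  have hnr : (n : ℝ) = r ^ 2 := by rw [hr, Real.sq_sqrt (by linarith)]
  have hr0 : 0 < r := by linarith
  rw [← hr] at ht' ⊢
  have ht1 : t ≤ 1 := by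
    have : 1 / (64 * r) ≤ 1 / 2 := one_div_le_one_div_of_le (by norm_num) (by linarith)
    linarith
  obtain ⟨h1, h2, -, h4⟩ := binomialMean_moments n t
  obtain ⟨b, hb⟩ : ∃ b, b = r * (2 * t - 1) := ⟨_, rfl⟩
  have hta : 2 * t - 1 = b / r := by rw [hb]; field_simp
  have hb0 : 0 ≤ b := hb ▸ mul_nonneg hr0.le (by linarith)
  have hb1 : b ≤ 1 / 32 := by
    have : 2 * t - 1 ≤ 1 / (32 * r) := by
      have : 1 / (32 * r) = 2 * (1 / (64 * r)) := by field_simp; norm_num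
      linarith
    calc b ≤ r * (1 / (32 * r)) := hb ▸ mul_le_mul_of_nonneg_left this hr0.le
      _ = 1 / 32 := by field_simp
  have h2' : r ^ 2 ≤ binomialMean n t (fun k => (2 * (k : ℝ) - n) ^ 2) := by
    rw [h2, ← hnr]
    have : 0 ≤ (n : ℝ) * (n - 1) * (2 * t - 1) ^ 2 :=
      mul_nonneg (mul_nonneg (by linarith) (by linarith)) (sq_nonneg _)
    linarith
  have h4' : binomialMean n t (fun k => (2 * (k : ℝ) - n) ^ 4) ≤ 10 * r ^ 4 := by
    have e2 : (n : ℝ) * (n - 1) * (6 * n - 8) * (2 * t - 1) ^ 2 =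
        (n - 1) * (6 * n - 8) * b ^ 2 := by
      rw [hnr, hta]; field_simp
    have e4 : (n : ℝ) * (n - 1) * (n - 2) * (n - 3) * (2 * t - 1) ^ 4 =
        (n - 1) * (n - 2) * (n - 3) / n * b ^ 4 := by
      rw [hnr, hta]; field_simp
    have b2 : b ^ 2 ≤ 1 := pow_le_one₀ hb0 (by linarith)
    have b4 : b ^ 4 ≤ 1 := pow_le_one₀ hb0 (by linarith)
    have c2 : ((n : ℝ) - 1) * (6 * n - 8) * b ^ 2 ≤ 6 * n ^ 2 * 1 :=
      mul_le_mul (by nlinarith) b2 (sq_nonneg b) (by positivity)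
    have c4 : ((n : ℝ) - 1) * (n - 2) * (n - 3) / n * b ^ 4 ≤ n ^ 2 * 1 := by
      refine mul_le_mul ?_ b4 (by positivity) (by positivity)
      rw [div_le_iff₀ (by linarith)]
      nlinarith [sq_nonneg ((n : ℝ) - 1)]
    have er : r ^ 4 = (n : ℝ) ^ 2 := by rw [hnr]; ring
    rw [h4, e2, e4, er]
    linarith
  have hlow : binomialMean n t (fun k => (-1 / (4 * r ^ 2)) * (2 * (k : ℝ) - n) +
      (1 / (16 * r ^ 3) * (2 * (k : ℝ) - n) ^ 2 +
        (-1 / (256 * r ^ 5)) * (2 * (k : ℝ) - n) ^ 4)) ≤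
      binomialMean n t (fun k => max (1 / 2 - (k : ℝ) / n) 0) := by
    refine binomialMean_mono (by linarith) ht1 fun k _ => ?_
    refine le_trans (le_of_eq ?_) (sub_add_le_posPart (s := 2 / r) (by positivity) _)
    rw [hnr]
    field_simp
    ring
  refine le_trans ?_ hlow
  rw [binomialMean_add, binomialMean_add, binomialMean_const_mul, binomialMean_const_mul,
    binomialMean_const_mul, h1]
  have e1 : (-1 / (4 * r ^ 2)) * ((n : ℝ) * (2 * t - 1)) = - (b / (4 * r)) := by
    rw [hnr, hta]; field_simp
  have e2 := mul_le_mul_of_nonneg_left h2' (show 0 ≤ 1 / (16 * r ^ 3) by positivity)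
  have e4 := mul_le_mul_of_nonneg_left h4' (show 0 ≤ 1 / (256 * r ^ 5) by positivity)
  have e2' : 1 / (16 * r ^ 3) * r ^ 2 = 1 / 16 * (1 / r) := by field_simp
  have e4' : 1 / (256 * r ^ 5) * (10 * r ^ 4) = 10 / 256 * (1 / r) := by field_simp
  have e1' : b / (4 * r) ≤ 1 / 128 * (1 / r) := by
    rw [div_le_iff₀ (by positivity)]; field_simp; linarith
  have e5 : 1 / (64 * r) = 1 / 64 * (1 / r) := by field_simp
  rw [e1, e5, neg_div, neg_mul]
  linarith

lemma integral_barLaw {μ : Measure ℝ} [IsFiniteMeasure μ] (hμ : ∀ᵐ t ∂μ, t ∈ Icc (0 : ℝ) 1)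
    (n : ℕ) (φ : ℝ → ℝ) :
    ∫ x, φ x ∂(barLaw μ n) = ∫ t, binomialMean n t (fun k => φ (k / n)) ∂μ := by
  have hint (k : ℕ) : Integrable (fun t : ℝ => t ^ k * (1 - t) ^ (n - k)) μ := by
    refine Integrable.of_bound (C := 1) (by fun_prop) ?_
    filter_upwards [hμ] with t ht
    have h0 := ht.1
    have h1 := sub_nonneg.mpr ht.2
    rw [Real.norm_of_nonneg (by positivity)]
    exact mul_le_one₀ (pow_le_one₀ h0 ht.2) (by positivity) (pow_le_one₀ h1 (by linarith))
  simp only [barLaw, binomialMean]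
  rw [integral_finsetSum_measure fun k _ =>
      (integrable_dirac (by simp)).smul_measure ENNReal.ofReal_ne_top,
    integral_finsetSum _ fun k _ => ((hint k).const_mul _).mul_const _]
  refine Finset.sum_congr rfl fun k _ => ?_
  rw [integral_smul_measure, integral_dirac, integral_mul_const, integral_const_mul,
    ENNReal.toReal_ofReal, smul_eq_mul]
  refine mul_nonneg (by positivity) (integral_nonneg_of_ae ?_)
  filter_upwards [hμ] with t ht
  have h0 := ht.1
  have h1 := sub_nonneg.mpr ht.2
  simp only [Pi.zero_apply]
  positivity

lemma bddAbove_dW_barLaw {μ : Measure ℝ} [IsFiniteMeasure μ]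
    (hμ : ∀ᵐ t ∂μ, t ∈ Icc (0 : ℝ) 1) (n : ℕ) :
    BddAbove (range fun φ : {f : ℝ → ℝ // LipschitzWith 1 f} =>
      |(∫ x, φ.1 x ∂(barLaw μ n)) - ∫ x, φ.1 x ∂μ|) := by
  have hdiff (φ : ℝ → ℝ) (hφ : LipschitzWith 1 φ) {x y : ℝ} (hx : x ∈ Icc (0 : ℝ) 1)
      (hy : y ∈ Icc (0 : ℝ) 1) : |φ x - φ y| ≤ 1 := by
    have h := hφ.dist_le_mul x y
    rw [Real.dist_eq, NNReal.coe_one, one_mul] at h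
    exact h.trans (by simpa using Real.dist_le_of_mem_Icc hx hy)
  have hnode (k : ℕ) (hk : k ≤ n) : (k : ℝ) / n ∈ Icc (0 : ℝ) 1 :=
    ⟨by positivity, div_le_one_of_le₀ (by exact_mod_cast hk) (by positivity)⟩
  have hmean (f : ℕ → ℝ) (c : ℝ) (h : ∀ k ≤ n, |f k - c| ≤ 1) {t : ℝ}
      (ht : t ∈ Icc (0 : ℝ) 1) : |binomialMean n t f - c| ≤ 1 := by
    have hc (d : ℝ) : binomialMean n t (fun _ => d * 1) = d := by
      rw [binomialMean_const_mul, binomialMean_one, mul_one]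
    have hup : binomialMean n t f ≤ binomialMean n t (fun _ => (c + 1) * 1) :=
      binomialMean_mono ht.1 ht.2 fun k hk => by linarith [(abs_le.mp (h k hk)).2]
    have hlo : binomialMean n t (fun _ => (c - 1) * 1) ≤ binomialMean n t f :=
      binomialMean_mono ht.1 ht.2 fun k hk => by linarith [(abs_le.mp (h k hk)).1]
    rw [hc] at hup hlo
    exact abs_le.mpr ⟨by linarith, by linarith⟩
  refine ⟨1 * μ.real univ, ?_⟩
  rintro _ ⟨⟨φ, hφ⟩, rfl⟩
  have hbound : ∀ᵐ t ∂μ, ‖binomialMean n t (fun k => φ (k / n)) - φ t‖ ≤ 1 := by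
    filter_upwards [hμ] with t ht
    exact hmean _ _ (fun k hk => hdiff φ hφ (hnode k hk) ht) ht
  have hφc := hφ.continuous
  have hφi : Integrable φ μ := by
    refine Integrable.of_bound (C := 1 + |φ 0|) (by fun_prop) ?_
    filter_upwards [hμ] with t ht
    have h1 := hdiff φ hφ ht (y := 0) (by simp)
    have h2 := abs_sub_abs_le_abs_sub (φ t) (φ 0)
    rw [Real.norm_eq_abs]
    linarith
  have hdi : Integrable (fun t => binomialMean n t (fun k => φ (k / n)) - φ t) μ :=
    Integrable.of_bound (C := 1) (by unfold binomialMean; fun_prop) hbound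
  have hmi : Integrable (fun t => binomialMean n t (fun k => φ (k / n))) μ := by
    exact (hdi.add hφi).congr (.of_forall fun t => sub_add_cancel _ _)
  simp only
  rw [integral_barLaw hμ, ← integral_sub hmi hφi]
  exact norm_integral_le_of_norm_le_const hbound

lemma withDensity_rpow_Ioo {γ : ℝ} (hγ : 0 < γ) {h : ℝ} (h0 : 0 ≤ h) (h1 : h ≤ 1 / 4) :
    (volume.restrict (Ioo (1 / 2 : ℝ) (3 / 4))).withDensity
      (fun x => ENNReal.ofReal (γ * (4 : ℝ) ^ γ * (x - 1 / 2) ^ (γ - 1)))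
      (Ioo (1 / 2) (1 / 2 + h)) = ENNReal.ofReal ((4 * h) ^ γ) := by
  have hle : (1 / 2 : ℝ) ≤ 1 / 2 + h := by linarith
  have hi : IntervalIntegrable (fun x : ℝ => γ * (4 : ℝ) ^ γ * (x - 1 / 2) ^ (γ - 1)) volume
      (1 / 2) (1 / 2 + h) := by
    have := (intervalIntegral.intervalIntegrable_rpow' (a := 0) (b := h)
      (r := γ - 1) (by linarith)).comp_sub_right (1 / 2)
    rw [zero_add, add_comm h] at this
    exact this.const_mul _
  rw [withDensity_apply _ measurableSet_Ioo, Measure.restrict_restrict measurableSet_Ioo,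
    inter_eq_left.mpr (Ioo_subset_Ioo_right (by linarith)),
    ← ofReal_integral_eq_lintegral_ofReal]
  · rw [← integral_Ioc_eq_integral_Ioo, ← intervalIntegral.integral_of_le hle,
      intervalIntegral.integral_const_mul,
      intervalIntegral.integral_comp_sub_right (fun x : ℝ => x ^ (γ - 1)) (1 / 2),
      integral_rpow (Or.inl (by linarith)), Real.mul_rpow (by norm_num) h0]
    congr 1
    simp only [sub_self, add_sub_cancel_left, sub_add_cancel, Real.zero_rpow hγ.ne', sub_zero]
    field_simp
  · exact ((intervalIntegrable_iff_integrableOn_Ioc_of_le hle).mp hi).mono_set Ioo_subset_Ioc_self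
  · filter_upwards [ae_restrict_mem measurableSet_Ioo] with x hx
    have := sub_nonneg.mpr hx.1.le
    simp only [Pi.zero_apply]
    positivity

/-- For `μ` with density `p(x) = γ 4^γ (x-1/2)^(γ-1)` on `(1/2, 3/4)`,
`d_W(X̄ₙ, θ) ≥ C n^{-(1+γ)/2}`. -/
theorem stmt_9 (γ : ℝ) (hγ : γ ∈ Set.Ioo (0 : ℝ) 1) (μ : Measure ℝ)
    (hμ : μ = (volume.restrict (Set.Ioo (1 / 2 : ℝ) (3 / 4))).withDensity
      fun x => ENNReal.ofReal (γ * (4 : ℝ) ^ γ * (x - 1 / 2) ^ (γ - 1))) :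
    ∃ C : ℝ, 0 < C ∧ ∀ n : ℕ, 1 ≤ n →
      C / (n : ℝ) ^ ((1 + γ) / 2) ≤ dW (barLaw μ n) μ := by
  have hsupp : ∀ᵐ t ∂μ, t ∈ Ioo (1 / 2 : ℝ) (3 / 4) := by
    rw [hμ]
    exact (withDensity_absolutelyContinuous _ _).ae_le (ae_restrict_mem measurableSet_Ioo)
  have hunit : ∀ᵐ t ∂μ, t ∈ Icc (0 : ℝ) 1 := by
    filter_upwards [hsupp] with t ht
    exact ⟨by linarith [ht.1], by linarith [ht.2]⟩
  have hIoo {h : ℝ} (h0 : 0 ≤ h) (h1 : h ≤ 1 / 4) :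
      μ (Ioo (1 / 2) (1 / 2 + h)) = ENNReal.ofReal ((4 * h) ^ γ) := by
    rw [hμ]
    exact withDensity_rpow_Ioo hγ.1 h0 h1
  have hfin : IsFiniteMeasure μ := by
    refine ⟨?_⟩
    rw [← measure_eq_measure_of_null_sdiff (subset_univ (Ioo (1 / 2 : ℝ) (1 / 2 + 1 / 4))),
      hIoo (by norm_num) le_rfl]
    · exact ENNReal.ofReal_lt_top
    · rw [← compl_eq_univ_sdiff]
      norm_num
      exact hsupp
  refine ⟨1 / 64 * (1 / 16) ^ γ, by positivity, fun n hn => ?_⟩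
  have hn0 : (0 : ℝ) < n := by exact_mod_cast hn
  have hsqrt : 1 ≤ √(n : ℝ) := Real.one_le_sqrt.mpr (by exact_mod_cast hn)
  have hlip : LipschitzWith 1 (fun x : ℝ => max (1 / 2 - x) 0) := by
    refine LipschitzWith.max_const (LipschitzWith.of_dist_le_mul fun x y => ?_) 0
    rw [dist_sub_left, NNReal.coe_one, one_mul]
  refine le_trans ?_ (le_ciSup (bddAbove_dW_barLaw hunit n) ⟨_, hlip⟩)
  have hzero : ∫ x, max (1 / 2 - x) 0 ∂μ = 0 := by
    refine integral_eq_zero_of_ae ?_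
    filter_upwards [hsupp] with t ht
    exact max_eq_right (by linarith [ht.1])
  simp only
  rw [hzero, sub_zero, integral_barLaw hunit]
  refine le_trans ?_ (le_abs_self _)
  set f : ℝ → ℝ := fun t => binomialMean n t fun k => max (1 / 2 - (k : ℝ) / n) 0
  have hpos : 0 ≤ᵐ[μ] f := by
    filter_upwards [hunit] with t ht
    have h0 : binomialMean n t (fun _ => 0 * 1) ≤ f t :=
      binomialMean_mono ht.1 ht.2 fun k _ => by simp
    rwa [binomialMean_const_mul, zero_mul] at h0
  have hint : Integrable f μ := by
    refine Integrable.of_bound (C := 1) (by unfold f binomialMean; fun_prop) ?_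
    filter_upwards [hunit, hpos] with t ht h0
    rw [Real.norm_of_nonneg h0, ← binomialMean_one n t]
    refine binomialMean_mono ht.1 ht.2 fun k _ => max_le ?_ zero_le_one
    have : (0 : ℝ) ≤ (k : ℝ) / n := by positivity
    linarith
  have hh : 1 / (64 * √(n : ℝ)) ≤ 1 / 4 :=
    one_div_le_one_div_of_le (by norm_num) (by linarith)
  calc 1 / 64 * (1 / 16) ^ γ / (n : ℝ) ^ ((1 + γ) / 2)
      = 1 / (64 * √(n : ℝ)) * μ.real (Ioo (1 / 2) (1 / 2 + 1 / (64 * √(n : ℝ)))) := by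
        rw [measureReal_def, hIoo (by positivity) hh, ENNReal.toReal_ofReal (by positivity),
          show (4 : ℝ) * (1 / (64 * √(n : ℝ))) = 1 / 16 / √(n : ℝ) by field_simp; norm_num,
          Real.div_rpow (x := 1 / 16) (y := √(n : ℝ)) (by norm_num) (by positivity),
          show (1 + γ) / 2 = 1 / 2 + 1 / 2 * γ by ring, Real.rpow_add hn0, Real.rpow_mul hn0.le,
          ← Real.sqrt_eq_rpow]
        field_simp
    _ ≤ ∫ t in Ioo (1 / 2) (1 / 2 + 1 / (64 * √(n : ℝ))), f t ∂μ :=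
        setIntegral_ge_of_const_le_real measurableSet_Ioo (measure_ne_top _ _)
          (fun t ht => le_binomialMean_posPart hn ht.1.le ht.2.le) hint.integrableOn
    _ ≤ ∫ t, f t ∂μ := setIntegral_le_integral hint hpos
end

section
/- Let μ be a probability measure on [0,1], θ of law μ, X̄_n of law P[X̄_n = k/n] = C(n,k) ∫_0^1 t^k (1-t)^{n-k} μ(dt), and δ > 0. If there exist constants 0 < c ≤ C such that c·n^{−δ} ≤ d_W(X̄_n, θ) ≤ C·n^{−δ} for all n ≥ 1, then δ ∈ [1/2, 1]. -/
open MeasureTheory ProbabilityTheory Set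

theorem bernstein_sum_one (n : ℕ) (t : ℝ) :
    ∑ k ∈ Finset.range (n + 1), (n.choose k : ℝ) * (t ^ k * (1 - t) ^ (n - k)) = 1 := by
  have h := congrArg (Polynomial.eval t) (bernsteinPolynomial.sum ℝ n)
  simpa [Polynomial.eval_finsetSum, bernsteinPolynomial, mul_assoc] using h

theorem bernstein_sum_sub {n : ℕ} (hn : 1 ≤ n) (t : ℝ) :
    ∑ k ∈ Finset.range (n + 1),
      (n.choose k : ℝ) * (t ^ k * (1 - t) ^ (n - k)) * ((k : ℝ) / n - t) = 0 := by
  have hn' : (n : ℝ) ≠ 0 := by positivity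
  have h := congrArg (Polynomial.eval t) (bernsteinPolynomial.sum_smul ℝ n)
  simp only [Polynomial.eval_finsetSum, bernsteinPolynomial, nsmul_eq_mul, Polynomial.eval_mul,
    Polynomial.eval_natCast, Polynomial.eval_pow, Polynomial.eval_X, Polynomial.eval_sub,
    Polynomial.eval_one] at h
  have h1 := bernstein_sum_one n t
  calc _ = (∑ k ∈ Finset.range (n + 1),
          (k : ℝ) * ((n.choose k : ℝ) * t ^ k * (1 - t) ^ (n - k))) / n -
        (∑ k ∈ Finset.range (n + 1), (n.choose k : ℝ) * (t ^ k * (1 - t) ^ (n - k))) * t := by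
        rw [Finset.sum_div, Finset.sum_mul, ← Finset.sum_sub_distrib]
        exact Finset.sum_congr rfl fun k _ => by ring
    _ = 0 := by rw [h, h1]; field_simp; ring

theorem bernstein_sum_sub_sq {n : ℕ} (hn : 1 ≤ n) (t : ℝ) :
    ∑ k ∈ Finset.range (n + 1),
      (n.choose k : ℝ) * (t ^ k * (1 - t) ^ (n - k)) * ((k : ℝ) / n - t) ^ 2 =
      t * (1 - t) / n := by
  have hn' : (n : ℝ) ≠ 0 := by positivity
  have h := congrArg (Polynomial.eval t) (bernsteinPolynomial.variance ℝ n)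
  simp only [Polynomial.eval_finsetSum, bernsteinPolynomial, nsmul_eq_mul, Polynomial.eval_mul,
    Polynomial.eval_natCast, Polynomial.eval_pow, Polynomial.eval_X, Polynomial.eval_sub,
    Polynomial.eval_one] at h
  calc _ = (∑ k ∈ Finset.range (n + 1),
          ((n : ℝ) * t - k) ^ 2 * ((n.choose k : ℝ) * t ^ k * (1 - t) ^ (n - k))) / (n : ℝ) ^ 2 := by
        rw [Finset.sum_div]
        exact Finset.sum_congr rfl fun k _ => by field_simp; ring
    _ = _ := by rw [h]; field_simp

section

variable {μ : Measure ℝ}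

theorem ae_mem_Icc (hsupp : μ (Icc (0 : ℝ) 1)ᶜ = 0) : ∀ᵐ t ∂μ, t ∈ Icc (0 : ℝ) 1 := hsupp

theorem integrable_of_continuous [IsProbabilityMeasure μ] (hsupp : μ (Icc (0 : ℝ) 1)ᶜ = 0)
    {f : ℝ → ℝ} (hf : Continuous f) : Integrable f μ := by
  obtain ⟨M, hM⟩ := isCompact_Icc.exists_bound_of_continuousOn (hf.continuousOn (s := Icc 0 1))
  exact Integrable.of_bound hf.aestronglyMeasurable M ((ae_mem_Icc hsupp).mono hM)

theorem bernstein_weight_nonneg {t : ℝ} (ht : t ∈ Icc (0 : ℝ) 1) (n k : ℕ) :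
    0 ≤ (n.choose k : ℝ) * (t ^ k * (1 - t) ^ (n - k)) := by
  have h0 := ht.1
  have h1 := sub_nonneg.2 ht.2
  positivity

theorem integral_barLaw_sub [IsProbabilityMeasure μ] (hsupp : μ (Icc (0 : ℝ) 1)ᶜ = 0)
    {f : ℝ → ℝ} (hf : Continuous f) (n : ℕ) :
    (∫ x, f x ∂barLaw μ n) - ∫ x, f x ∂μ =
      ∫ t, ∑ k ∈ Finset.range (n + 1),
        (n.choose k : ℝ) * (t ^ k * (1 - t) ^ (n - k)) * (f ((k : ℝ) / n) - f t) ∂μ := by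
  have hw (k : ℕ) : 0 ≤ (n.choose k : ℝ) * ∫ t, t ^ k * (1 - t) ^ (n - k) ∂μ := by
    rw [← integral_const_mul]
    exact integral_nonneg_of_ae ((ae_mem_Icc hsupp).mono fun t ht =>
      bernstein_weight_nonneg ht n k)
  have h1 : ∫ x, f x ∂barLaw μ n = ∫ t, ∑ k ∈ Finset.range (n + 1),
      (n.choose k : ℝ) * (t ^ k * (1 - t) ^ (n - k)) * f ((k : ℝ) / n) ∂μ := by
    rw [barLaw, integral_finsetSum_measure, integral_finsetSum]
    · refine Finset.sum_congr rfl fun k _ => ?_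
      rw [integral_smul_measure, integral_dirac, ENNReal.toReal_ofReal (hw k), smul_eq_mul,
        integral_mul_const, integral_const_mul]
    · exact fun k _ => integrable_of_continuous hsupp (by fun_prop)
    · exact fun k _ => (integrable_dirac (by simp)).smul_measure ENNReal.ofReal_ne_top
  rw [h1, ← integral_sub (integrable_of_continuous hsupp (by fun_prop))
    (integrable_of_continuous hsupp hf)]
  congr 1 with t
  simp only [mul_sub, Finset.sum_sub_distrib]
  rw [← Finset.sum_mul, bernstein_sum_one, one_mul]

theorem abs_integral_barLaw_sub_le [IsProbabilityMeasure μ] (hsupp : μ (Icc (0 : ℝ) 1)ᶜ = 0)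
    {f : ℝ → ℝ} (hf : LipschitzWith 1 f) {n : ℕ} (hn : 1 ≤ n) {s : ℝ} (hs : 0 < s) :
    |(∫ x, f x ∂barLaw μ n) - ∫ x, f x ∂μ| ≤
      (s * ((∫ t, t * (1 - t) ∂μ) / n) + s⁻¹) / 2 := by
  have hfc := hf.continuous
  rw [integral_barLaw_sub hsupp hfc]
  have key : ∀ᵐ t ∂μ, ‖∑ k ∈ Finset.range (n + 1),
      (n.choose k : ℝ) * (t ^ k * (1 - t) ^ (n - k)) * (f ((k : ℝ) / n) - f t)‖ ≤
      (s * (t * (1 - t) / n) + s⁻¹) / 2 := by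
    filter_upwards [ae_mem_Icc hsupp] with t ht
    have hterm (x : ℝ) : |f x - f t| ≤ (s * (x - t) ^ 2 + s⁻¹) / 2 := by
      have h1 : |f x - f t| ≤ |x - t| := by
        simpa [Real.dist_eq] using hf.dist_le_mul x t
      have h2 : 0 ≤ s⁻¹ * (s * |x - t| - 1) ^ 2 := by positivity
      have h3 : s⁻¹ * (s * |x - t| - 1) ^ 2 = s * |x - t| ^ 2 + s⁻¹ - 2 * |x - t| := by
        field_simp; ring
      rw [sq_abs] at h3
      linarith
    calc _ ≤ ∑ k ∈ Finset.range (n + 1), (n.choose k : ℝ) * (t ^ k * (1 - t) ^ (n - k)) *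
          ((s * ((k : ℝ) / n - t) ^ 2 + s⁻¹) / 2) := by
          refine (norm_sum_le _ _).trans (Finset.sum_le_sum fun k _ => ?_)
          rw [norm_mul, Real.norm_of_nonneg (bernstein_weight_nonneg ht n k), Real.norm_eq_abs]
          exact mul_le_mul_of_nonneg_left (hterm _) (bernstein_weight_nonneg ht n k)
      _ = (s * ∑ k ∈ Finset.range (n + 1), (n.choose k : ℝ) * (t ^ k * (1 - t) ^ (n - k)) *
            ((k : ℝ) / n - t) ^ 2 + (∑ k ∈ Finset.range (n + 1),
            (n.choose k : ℝ) * (t ^ k * (1 - t) ^ (n - k))) * s⁻¹) / 2 := by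
          rw [Finset.mul_sum, Finset.sum_mul, ← Finset.sum_add_distrib, Finset.sum_div]
          exact Finset.sum_congr rfl fun k _ => by ring
      _ = _ := by rw [bernstein_sum_sub_sq hn, bernstein_sum_one, one_mul]
  rw [← Real.norm_eq_abs]
  refine (norm_integral_le_of_norm_le (integrable_of_continuous hsupp (by fun_prop)) key).trans
    (le_of_eq ?_)
  rw [integral_div, integral_add (integrable_of_continuous hsupp (by fun_prop))
    (integrable_of_continuous hsupp (by fun_prop)), integral_const_mul, integral_div]
  simp

theorem dW_barLaw_le [IsProbabilityMeasure μ] (hsupp : μ (Icc (0 : ℝ) 1)ᶜ = 0)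
    {n : ℕ} (hn : 1 ≤ n) {s : ℝ} (hs : 0 < s) :
    dW (barLaw μ n) μ ≤ (s * ((∫ t, t * (1 - t) ∂μ) / n) + s⁻¹) / 2 :=
  haveI : Nonempty {f : ℝ → ℝ // LipschitzWith 1 f} := ⟨⟨id, LipschitzWith.id⟩⟩
  ciSup_le fun φ => abs_integral_barLaw_sub_le hsupp φ.2 hn hs

theorem lipschitzWith_clamp_sq_div_two :
    LipschitzWith 1 fun x : ℝ => (max 0 (min 1 x)) ^ 2 / 2 := by
  refine LipschitzWith.of_dist_le_mul fun x y => ?_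
  simp only [Real.dist_eq, NNReal.coe_one, one_mul]
  have hc : |max 0 (min 1 x) - max 0 (min 1 y)| ≤ |x - y| := by
    have h : LipschitzWith 1 fun x : ℝ => max 0 (min 1 x) :=
      (LipschitzWith.id.const_min 1).const_max 0
    simpa [Real.dist_eq] using h.dist_le_mul x y
  have hx : max 0 (min 1 x) ≤ 1 := by simp
  have hy : max 0 (min 1 y) ≤ 1 := by simp
  have hx0 : 0 ≤ max 0 (min 1 x) := le_max_left _ _
  have hy0 : 0 ≤ max 0 (min 1 y) := le_max_left _ _
  generalize max 0 (min 1 x) = a at *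
  generalize max 0 (min 1 y) = b at *
  rw [show a ^ 2 / 2 - b ^ 2 / 2 = (a - b) * ((a + b) / 2) by ring, abs_mul,
    abs_of_nonneg (by linarith : 0 ≤ (a + b) / 2)]
  nlinarith [abs_nonneg (a - b)]

theorem le_dW_barLaw [IsProbabilityMeasure μ] (hsupp : μ (Icc (0 : ℝ) 1)ᶜ = 0)
    {n : ℕ} (hn : 1 ≤ n) :
    (∫ t, t * (1 - t) ∂μ) / n / 2 ≤ dW (barLaw μ n) μ := by
  have hn' : (0 : ℝ) < n := by positivity
  have hbdd : BddAbove (range fun φ : {f : ℝ → ℝ // LipschitzWith 1 f} =>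
      |(∫ x, φ.1 x ∂barLaw μ n) - ∫ x, φ.1 x ∂μ|) :=
    ⟨_, forall_mem_range.2 fun φ => abs_integral_barLaw_sub_le hsupp φ.2 hn one_pos⟩
  refine le_trans ?_ (le_ciSup hbdd ⟨_, lipschitzWith_clamp_sq_div_two⟩)
  refine le_trans (le_of_eq ?_) (le_abs_self _)
  rw [integral_barLaw_sub hsupp lipschitzWith_clamp_sq_div_two.continuous, ← integral_div,
    ← integral_div]
  refine integral_congr_ae ?_
  filter_upwards [ae_mem_Icc hsupp] with t ht
  have clamp {x : ℝ} (hx : x ∈ Icc (0 : ℝ) 1) : max 0 (min 1 x) = x := by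
    rw [min_eq_right hx.2, max_eq_right hx.1]
  calc t * (1 - t) / n / 2
      = (∑ k ∈ Finset.range (n + 1), (n.choose k : ℝ) * (t ^ k * (1 - t) ^ (n - k)) *
          ((k : ℝ) / n - t) ^ 2) / 2 + t * ∑ k ∈ Finset.range (n + 1),
          (n.choose k : ℝ) * (t ^ k * (1 - t) ^ (n - k)) * ((k : ℝ) / n - t) := by
        rw [bernstein_sum_sub_sq hn, bernstein_sum_sub hn, mul_zero, add_zero]
    _ = _ := by
        rw [Finset.sum_div, Finset.mul_sum, ← Finset.sum_add_distrib]
        refine Finset.sum_congr rfl fun k hk => ?_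
        have hk' : (k : ℝ) / n ∈ Icc (0 : ℝ) 1 :=
          ⟨by positivity, (div_le_one hn').2 (by
            exact_mod_cast Nat.lt_succ_iff.1 (Finset.mem_range.1 hk))⟩
        rw [clamp ht, clamp hk']
        ring

end

theorem exponent_le_of_forall_mul_rpow_le {a A p q : ℝ} (ha : 0 < a)
    (h : ∀ n : ℕ, 1 ≤ n → a * (n : ℝ) ^ (-p) ≤ A * (n : ℝ) ^ (-q)) : q ≤ p := by
  by_contra! hpq
  have ht := ((tendsto_rpow_atTop (sub_pos.2 hpq)).comp
    tendsto_natCast_atTop_atTop).eventually_gt_atTop (A / a)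
  obtain ⟨n, hn, hn1⟩ := (ht.and (Filter.eventually_ge_atTop 1)).exists
  have hn0 : (0 : ℝ) < n := by positivity
  have h1 := h n hn1
  have hq : (n : ℝ) ^ (-p) = (n : ℝ) ^ (q - p) * (n : ℝ) ^ (-q) := by
    rw [← Real.rpow_add hn0]; ring_nf
  rw [hq, ← mul_assoc] at h1
  have h2 := le_of_mul_le_mul_right h1 (Real.rpow_pos_of_pos hn0 _)
  simp only [Function.comp_apply] at hn
  rw [div_lt_iff₀ ha] at hn
  linarith

/-- Conversely: if `d_W(X̄ₙ, θ) ≍ n^{-δ}` for some `δ > 0`, then `δ ∈ [1/2, 1]`. -/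
theorem stmt_11 (μ : Measure ℝ) [IsProbabilityMeasure μ]
    (hsupp : μ (Set.Icc (0 : ℝ) 1)ᶜ = 0) (δ : ℝ) (hδ : 0 < δ)
    (c C : ℝ) (hc : 0 < c) (hcC : c ≤ C)
    (h : ∀ n : ℕ, 1 ≤ n →
      c * (n : ℝ) ^ (-δ) ≤ dW (barLaw μ n) μ ∧
      dW (barLaw μ n) μ ≤ C * (n : ℝ) ^ (-δ)) :
    δ ∈ Set.Icc (1 / 2 : ℝ) 1 := by
  set m := ∫ t, t * (1 - t) ∂μ with hm_def
  have hm : 0 < m := by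
    have h1 := (h 1 le_rfl).1.trans (dW_barLaw_le hsupp le_rfl (inv_pos.2 hc))
    rw [← hm_def] at h1
    simp only [Nat.cast_one, Real.one_rpow, mul_one, div_one, inv_inv] at h1
    have h2 : 0 < c⁻¹ * m := by linarith
    exact pos_of_mul_pos_right h2 (inv_pos.2 hc).le
  constructor
  · refine exponent_le_of_forall_mul_rpow_le hc (A := (m + 1) / 2) fun n hn => ?_
    have hn0 : (0 : ℝ) < n := by positivity
    refine ((h n hn).1.trans (dW_barLaw_le hsupp hn (Real.sqrt_pos.2 hn0))).trans (le_of_eq ?_)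
    rw [← hm_def, Real.rpow_neg hn0.le, ← Real.sqrt_eq_rpow]
    have hs : √(n : ℝ) ≠ 0 := (Real.sqrt_pos.2 hn0).ne'
    have hsq : (n : ℝ) = √(n : ℝ) * √(n : ℝ) := (Real.mul_self_sqrt hn0.le).symm
    have hdiv : √(n : ℝ) * (m / n) = m * (√(n : ℝ))⁻¹ := by
      nth_rewrite 2 [hsq]
      field_simp
    rw [hdiv]
    ring
  · refine exponent_le_of_forall_mul_rpow_le (half_pos hm) (p := 1) (A := C) fun n hn => ?_
    refine le_trans (le_of_eq ?_) ((le_dW_barLaw hsupp hn).trans (h n hn).2)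
    rw [← hm_def, Real.rpow_neg_one]
    ring
end

section
/- Let γ ∈ (0,1), let F_Z denote the standard normal cumulative distribution function and ω(x) = (2π)^{−1/2} e^{−x²/2} the standard normal density. Then ∫_0^∞ t^γ F_Z(−2t) dt = (γ / (2(γ+1))) ∫_0^∞ t^{γ−1} ω(2t) dt, and consequently ∫_0^∞ t^{γ−1} ( −t·F_Z(−2t) + (1/2)·ω(2t) ) dt = (1/(2(γ+1))) ∫_0^∞ t^{γ−1} ω(2t) dt > 0. -/
open MeasureTheory ProbabilityTheory Set

/-- Standard normal density `ω(x) = (2π)^(-1/2) e^(-x²/2)`. -/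
noncomputable def stdNormalPDF (x : ℝ) : ℝ :=
  (Real.sqrt (2 * Real.pi))⁻¹ * Real.exp (-x ^ 2 / 2)

/-- Standard normal cumulative distribution function. -/
noncomputable def stdNormalCDF (t : ℝ) : ℝ :=
  ((gaussianReal 0 1) (Set.Iic t)).toReal

open Filter Topology in
lemma tendsto_rpow_mul_exp_neg_mul_sq_atTop {b : ℝ} (hb : 0 < b) (s : ℝ) :
    Tendsto (fun x : ℝ => x ^ s * Real.exp (-b * x ^ 2)) atTop (𝓝 0) :=
  (rpow_mul_exp_neg_mul_sq_isLittleO_exp_neg hb s).trans_tendsto <|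
    Real.tendsto_exp_atBot.comp <| tendsto_id.const_mul_atTop_of_neg (by norm_num)

lemma gaussianPDFReal_zero_one : gaussianPDFReal 0 1 = stdNormalPDF := by
  ext x
  simp [gaussianPDFReal, stdNormalPDF]

lemma stdNormalPDF_pos (x : ℝ) : 0 < stdNormalPDF x := by
  rw [← gaussianPDFReal_zero_one]
  exact gaussianPDFReal_pos 0 1 x one_ne_zero

lemma integrable_stdNormalPDF : Integrable stdNormalPDF := by
  rw [← gaussianPDFReal_zero_one]
  exact integrable_gaussianPDFReal 0 1

lemma continuous_stdNormalPDF : Continuous stdNormalPDF := by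
  unfold stdNormalPDF
  fun_prop

lemma stdNormalPDF_two_mul (t : ℝ) :
    stdNormalPDF (2 * t) = (Real.sqrt (2 * Real.pi))⁻¹ * Real.exp (-2 * t ^ 2) := by
  unfold stdNormalPDF
  ring_nf

lemma hasDerivAt_stdNormalPDF (x : ℝ) : HasDerivAt stdNormalPDF (-x * stdNormalPDF x) x := by
  have h : HasDerivAt (fun y : ℝ => -y ^ 2 / 2) (-x) x := by
    convert! ((hasDerivAt_pow 2 x).neg.div_const 2) using 1
    ring
  convert! h.exp.const_mul (Real.sqrt (2 * Real.pi))⁻¹ using 1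
  unfold stdNormalPDF
  ring

lemma stdNormalCDF_eq_integral (x : ℝ) : stdNormalCDF x = ∫ y in Iic x, stdNormalPDF y := by
  rw [stdNormalCDF, gaussianReal_apply_eq_integral 0 one_ne_zero, gaussianPDFReal_zero_one,
    ENNReal.toReal_ofReal (integral_nonneg fun y => (stdNormalPDF_pos y).le)]

lemma hasDerivAt_stdNormalCDF (x : ℝ) : HasDerivAt stdNormalCDF (stdNormalPDF x) x := by
  have h : stdNormalCDF = fun y => stdNormalCDF 0 + ∫ z in (0 : ℝ)..y, stdNormalPDF z := by
    ext y
    rw [← intervalIntegral.integral_Iic_sub_Iic integrable_stdNormalPDF.integrableOn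
      integrable_stdNormalPDF.integrableOn, stdNormalCDF_eq_integral, stdNormalCDF_eq_integral]
    ring
  rw [h]
  exact (intervalIntegral.integral_hasDerivAt_right integrable_stdNormalPDF.intervalIntegrable
    (continuous_stdNormalPDF.stronglyMeasurableAtFilter _ _)
    continuous_stdNormalPDF.continuousAt).const_add _

lemma stdNormalCDF_nonneg (x : ℝ) : 0 ≤ stdNormalCDF x := ENNReal.toReal_nonneg

/-- Chernoff bound for the lower Gaussian tail. -/
lemma stdNormalCDF_neg_le {x : ℝ} (hx : 0 ≤ x) : stdNormalCDF (-x) ≤ Real.exp (-x ^ 2 / 2) := by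
  have h := measure_le_le_exp_mul_mgf (μ := gaussianReal 0 1) (X := fun y => y) (-x)
    (neg_nonpos.mpr hx) (integrable_exp_mul_gaussianReal (-x))
  rw [mgf_fun_id_gaussianReal, ← Real.exp_add] at h
  refine h.trans_eq (congrArg Real.exp ?_)
  push_cast
  ring

lemma stdNormalCDF_neg_two_mul_le {t : ℝ} (ht : 0 ≤ t) :
    stdNormalCDF (-(2 * t)) ≤ Real.exp (-2 * t ^ 2) := by
  refine (stdNormalCDF_neg_le (by positivity)).trans_eq (congrArg Real.exp ?_)
  ring

lemma hasDerivAt_stdNormalCDF_neg_two_mul (t : ℝ) :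
    HasDerivAt (fun t => stdNormalCDF (-(2 * t))) (-2 * stdNormalPDF (2 * t)) t := by
  have h : HasDerivAt (fun t : ℝ => -(2 * t)) (-2) t := by
    simpa using ((hasDerivAt_id t).const_mul 2).fun_neg
  convert! (hasDerivAt_stdNormalCDF (-(2 * t))).comp t h using 1
  simp [stdNormalPDF, mul_comm]

lemma hasDerivAt_stdNormalPDF_two_mul (t : ℝ) :
    HasDerivAt (fun t => stdNormalPDF (2 * t)) (-4 * t * stdNormalPDF (2 * t)) t := by
  have h : HasDerivAt (fun t : ℝ => 2 * t) 2 t := by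
    simpa using (hasDerivAt_id t).const_mul 2
  convert! (hasDerivAt_stdNormalPDF (2 * t)).comp t h using 1
  ring

lemma integrableOn_rpow_mul_stdNormalPDF {s : ℝ} (hs : -1 < s) :
    IntegrableOn (fun t : ℝ => t ^ s * stdNormalPDF (2 * t)) (Ioi 0) := by
  refine ((integrableOn_rpow_mul_exp_neg_mul_sq two_pos hs).const_mul
    (Real.sqrt (2 * Real.pi))⁻¹).congr (ae_of_all _ fun t => ?_)
  simp only [stdNormalPDF_two_mul]
  ring

lemma rpow_mul_stdNormalCDF_le (s : ℝ) {t : ℝ} (ht : 0 ≤ t) :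
    t ^ s * stdNormalCDF (-(2 * t)) ≤ t ^ s * Real.exp (-2 * t ^ 2) :=
  mul_le_mul_of_nonneg_left (stdNormalCDF_neg_two_mul_le ht) (Real.rpow_nonneg ht s)

lemma integrableOn_rpow_mul_stdNormalCDF {s : ℝ} (hs : -1 < s) :
    IntegrableOn (fun t : ℝ => t ^ s * stdNormalCDF (-(2 * t))) (Ioi 0) := by
  have hc : Continuous fun t : ℝ => stdNormalCDF (-(2 * t)) :=
    continuous_iff_continuousAt.mpr fun t => (hasDerivAt_stdNormalCDF_neg_two_mul t).continuousAt
  refine Integrable.mono' (integrableOn_rpow_mul_exp_neg_mul_sq two_pos hs)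
    (((measurable_id.pow_const s).mul hc.measurable).aestronglyMeasurable) ?_
  filter_upwards [ae_restrict_mem measurableSet_Ioi] with t ht
  have ht' : 0 ≤ t := le_of_lt ht
  rw [Real.norm_of_nonneg (mul_nonneg (Real.rpow_nonneg ht' s) (stdNormalCDF_nonneg _))]
  exact rpow_mul_stdNormalCDF_le s ht'

open Filter Topology in
lemma tendsto_rpow_mul_stdNormalCDF_atTop (s : ℝ) :
    Tendsto (fun t : ℝ => t ^ s * stdNormalCDF (-(2 * t))) atTop (𝓝 0) := by
  refine squeeze_zero' ?_ ?_ (tendsto_rpow_mul_exp_neg_mul_sq_atTop two_pos s)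
  · filter_upwards [eventually_ge_atTop 0] with t ht
    exact mul_nonneg (Real.rpow_nonneg ht s) (stdNormalCDF_nonneg _)
  · filter_upwards [eventually_ge_atTop 0] with t ht
    exact rpow_mul_stdNormalCDF_le s ht

open Filter Topology in
lemma tendsto_rpow_mul_stdNormalPDF_atTop (s : ℝ) :
    Tendsto (fun t : ℝ => t ^ s * stdNormalPDF (2 * t)) atTop (𝓝 0) := by
  have h := (tendsto_rpow_mul_exp_neg_mul_sq_atTop two_pos s).const_mul
    (Real.sqrt (2 * Real.pi))⁻¹
  rw [mul_zero] at h
  refine h.congr fun t => ?_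
  rw [stdNormalPDF_two_mul]
  ring

lemma integral_rpow_mul_stdNormalCDF {s : ℝ} (hs : 0 < s) :
    ∫ t in Ioi (0 : ℝ), t ^ s * stdNormalCDF (-(2 * t)) =
      (s / (2 * (s + 1))) * ∫ t in Ioi (0 : ℝ), t ^ (s - 1) * stdNormalPDF (2 * t) := by
  have hs1 : s + 1 ≠ 0 := by positivity
  have hF := integrableOn_rpow_mul_stdNormalCDF (s := s) (by linarith)
  have hω := (integrableOn_rpow_mul_stdNormalPDF (s := s - 1) (by linarith)).const_mul
    (s / (2 * (s + 1)))
  have hderiv : ∀ t ∈ Ioi (0 : ℝ), HasDerivAt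
      (fun t : ℝ => (s + 1)⁻¹ * (t ^ (s + 1) * stdNormalCDF (-(2 * t))) -
        (2 * (s + 1))⁻¹ * (t ^ s * stdNormalPDF (2 * t)))
      (t ^ s * stdNormalCDF (-(2 * t)) -
        s / (2 * (s + 1)) * (t ^ (s - 1) * stdNormalPDF (2 * t))) t := by
    intro t ht
    have ht0 : t ≠ 0 := ne_of_gt ht
    have h₁ := ((Real.hasDerivAt_rpow_const (p := s + 1) (Or.inl ht0)).mul
      (hasDerivAt_stdNormalCDF_neg_two_mul t)).const_mul (s + 1)⁻¹
    have h₂ := ((Real.hasDerivAt_rpow_const (p := s) (Or.inl ht0)).mul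
      (hasDerivAt_stdNormalPDF_two_mul t)).const_mul (2 * (s + 1))⁻¹
    convert! h₁.sub h₂ using 1
    rw [add_sub_cancel_right, Real.rpow_add_one ht0]
    field_simp
    ring
  have hcont : ContinuousWithinAt
      (fun t : ℝ => (s + 1)⁻¹ * (t ^ (s + 1) * stdNormalCDF (-(2 * t))) -
        (2 * (s + 1))⁻¹ * (t ^ s * stdNormalPDF (2 * t))) (Ici 0) 0 := by
    refine ContinuousAt.continuousWithinAt (ContinuousAt.sub ?_ ?_)
    · exact ((Real.continuousAt_rpow_const 0 (s + 1) (Or.inr (by positivity))).mul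
        (hasDerivAt_stdNormalCDF_neg_two_mul 0).continuousAt).const_mul _
    · exact ((Real.continuousAt_rpow_const 0 s (Or.inr hs.le)).mul
        (hasDerivAt_stdNormalPDF_two_mul 0).continuousAt).const_mul _
  have h := integral_Ioi_of_hasDerivAt_of_tendsto hcont hderiv (hF.sub hω)
    (((tendsto_rpow_mul_stdNormalCDF_atTop (s + 1)).const_mul _).sub
      ((tendsto_rpow_mul_stdNormalPDF_atTop s).const_mul _))
  rw [integral_sub hF hω, integral_const_mul, Real.zero_rpow hs1, Real.zero_rpow hs.ne'] at h
  linarith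

lemma integral_rpow_mul_stdNormalPDF_pos {s : ℝ} (hs : -1 < s) :
    0 < ∫ t in Ioi (0 : ℝ), t ^ s * stdNormalPDF (2 * t) := by
  have hpos : ∀ t ∈ Ioi (0 : ℝ), 0 < t ^ s * stdNormalPDF (2 * t) := fun t ht =>
    mul_pos (Real.rpow_pos_of_pos ht s) (stdNormalPDF_pos _)
  rw [setIntegral_pos_iff_support_of_nonneg_ae
    ((ae_restrict_mem measurableSet_Ioi).mono fun t ht => (hpos t ht).le)
    (integrableOn_rpow_mul_stdNormalPDF hs),
    inter_eq_right.mpr fun t ht => Function.mem_support.mpr (hpos t ht).ne']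
  simp

/-- For `γ ∈ (0,1)`:
`∫₀^∞ t^γ F_Z(-2t) dt = (γ/(2(γ+1))) ∫₀^∞ t^(γ-1) ω(2t) dt`, and consequently
`∫₀^∞ t^(γ-1)(-t F_Z(-2t) + ω(2t)/2) dt = (1/(2(γ+1))) ∫₀^∞ t^(γ-1) ω(2t) dt > 0`. -/
theorem stmt_15 (γ : ℝ) (hγ : γ ∈ Set.Ioo (0 : ℝ) 1) :
    (∫ t in Set.Ioi (0 : ℝ), t ^ γ * stdNormalCDF (-(2 * t))) =
      (γ / (2 * (γ + 1))) * ∫ t in Set.Ioi (0 : ℝ), t ^ (γ - 1) * stdNormalPDF (2 * t) ∧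
    (∫ t in Set.Ioi (0 : ℝ),
        t ^ (γ - 1) * (-t * stdNormalCDF (-(2 * t)) + stdNormalPDF (2 * t) / 2)) =
      (1 / (2 * (γ + 1))) * ∫ t in Set.Ioi (0 : ℝ), t ^ (γ - 1) * stdNormalPDF (2 * t) ∧
    0 < (1 / (2 * (γ + 1))) * ∫ t in Set.Ioi (0 : ℝ), t ^ (γ - 1) * stdNormalPDF (2 * t) := by
  obtain ⟨hγ0, -⟩ := hγ
  have hγ1 : 0 < γ + 1 := by positivity
  have hs : -1 < γ - 1 := by linarith
  refine ⟨integral_rpow_mul_stdNormalCDF hγ0, ?_,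
    mul_pos (by positivity) (integral_rpow_mul_stdNormalPDF_pos hs)⟩
  have hF := integrableOn_rpow_mul_stdNormalCDF (s := γ) (by linarith)
  have hω := (integrableOn_rpow_mul_stdNormalPDF hs).const_mul (1 / 2)
  calc
    _ = ∫ t in Ioi (0 : ℝ), 1 / 2 * (t ^ (γ - 1) * stdNormalPDF (2 * t)) -
          t ^ γ * stdNormalCDF (-(2 * t)) := by
      refine setIntegral_congr_fun measurableSet_Ioi fun t ht => ?_
      have ht0 : t ≠ 0 := ne_of_gt ht
      simp only [Real.rpow_sub_one ht0]
      field_simp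
      ring
    _ = _ := by
      rw [integral_sub hω hF, integral_const_mul, integral_rpow_mul_stdNormalCDF hγ0]
      field_simp
      ring
end

section
/- Let μ be a probability measure on [0,1] with μ({0,1}) = 0, let θ have law μ, and let Z be a standard normal random variable independent of θ. Then there exists a constant C > 0 (depending only on μ) such that for all n ≥ 1, d_W(θ + √(θ(1−θ)/n) Z, θ) ≥ C/n. -/
open MeasureTheory ProbabilityTheory Set

/-- Law of `θ + √(θ(1-θ)/n)·Z` where `θ ~ μ` and `Z` is an independent standard normal. -/
noncomputable def perturbedLaw (μ : Measure ℝ) (n : ℕ) : Measure ℝ :=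
  Measure.map (fun q : ℝ × ℝ => q.1 + Real.sqrt (q.1 * (1 - q.1) / n) * q.2)
    (μ.prod (gaussianReal 0 1))

theorem LipschitzWith.abs_integral_sub_integral_le {P Q : Measure ℝ} [IsProbabilityMeasure P]
    [IsProbabilityMeasure Q] (hP : Integrable id P) (hQ : Integrable id Q) {f : ℝ → ℝ}
    (hf : LipschitzWith 1 f) :
    |(∫ x, f x ∂P) - ∫ x, f x ∂Q| ≤ (∫ x, |x| ∂P) + ∫ x, |x| ∂Q := by
  have hle (x : ℝ) : |f x - f 0| ≤ |x| := by
    simpa [Real.dist_eq] using hf.dist_le_mul x 0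
  have key (ρ : Measure ℝ) [IsProbabilityMeasure ρ] (hρ : Integrable id ρ) :
      |(∫ x, f x ∂ρ) - f 0| ≤ ∫ x, |x| ∂ρ := by
    have habs : Integrable (fun x : ℝ => |x|) ρ := hρ.abs
    have hsub : Integrable (fun x => f x - f 0) ρ :=
      habs.mono' (by have := hf.continuous; fun_prop) (Filter.Eventually.of_forall hle)
    have hint : Integrable f ρ :=
      (hsub.add (integrable_const (f 0))).congr (Filter.Eventually.of_forall fun x => by simp)
    have heq : (∫ x, f x ∂ρ) - f 0 = ∫ x, (f x - f 0) ∂ρ := by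
      rw [integral_sub hint (integrable_const _)]
      simp
    rw [heq]
    exact abs_integral_le_integral_abs.trans (integral_mono hsub.abs habs hle)
  have h₁ := abs_le.1 (key P hP)
  have h₂ := abs_le.1 (key Q hQ)
  exact abs_le.2 ⟨by linarith, by linarith⟩

theorem abs_integral_sub_integral_le_dW {P Q : Measure ℝ} [IsProbabilityMeasure P]
    [IsProbabilityMeasure Q] (hP : Integrable id P) (hQ : Integrable id Q) {f : ℝ → ℝ}
    (hf : LipschitzWith 1 f) :
    |(∫ x, f x ∂P) - ∫ x, f x ∂Q| ≤ dW P Q := by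
  refine le_ciSup (f := fun φ : {f : ℝ → ℝ // LipschitzWith 1 f} =>
    |(∫ x, φ.1 x ∂P) - ∫ x, φ.1 x ∂Q|) ?_ ⟨f, hf⟩
  refine ⟨(∫ x, |x| ∂P) + ∫ x, |x| ∂Q, ?_⟩
  rintro _ ⟨φ, rfl⟩
  exact φ.2.abs_integral_sub_integral_le hP hQ

theorem integral_cos_add_mul_gaussianReal (a s : ℝ) :
    ∫ z, Real.cos (a + s * z) ∂gaussianReal 0 1 = Real.cos a * Real.exp (-(s ^ 2 / 2)) := by
  have hint : Integrable (fun z : ℝ => Complex.exp ((a + s * z : ℝ) * Complex.I))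
      (gaussianReal 0 1) := by
    refine (integrable_const (1 : ℝ)).mono' (by fun_prop) (Filter.Eventually.of_forall fun z => ?_)
    rw [Complex.norm_exp_ofReal_mul_I]
  have hre : ∀ z : ℝ, Real.cos (a + s * z) =
      RCLike.re (Complex.exp ((a + s * z : ℝ) * Complex.I)) := fun z =>
    (Complex.exp_ofReal_mul_I_re _).symm
  have hchar := charFun_gaussianReal (μ := 0) (v := 1) s
  rw [charFun_apply_real] at hchar
  simp_rw [hre]
  rw [integral_re hint]
  have hsplit : ∀ z : ℝ, Complex.exp ((a + s * z : ℝ) * Complex.I) =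
      Complex.exp (a * Complex.I) * Complex.exp (s * z * Complex.I) := fun z => by
    rw [← Complex.exp_add]; push_cast; ring_nf
  simp_rw [hsplit]
  rw [integral_const_mul, hchar]
  have hexp : Complex.exp (s * (0 : ℝ) * Complex.I - ((1 : NNReal) : ℝ) * s ^ 2 / 2) =
      (Real.exp (-(s ^ 2 / 2)) : ℝ) := by
    push_cast
    congr 1
    ring
  rw [hexp]
  change (Complex.exp (a * Complex.I) * (Real.exp (-(s ^ 2 / 2)) : ℝ)).re = _
  rw [Complex.re_mul_ofReal, Complex.exp_ofReal_mul_I_re]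

theorem measurable_perturbation (n : ℕ) :
    Measurable (fun q : ℝ × ℝ => q.1 + Real.sqrt (q.1 * (1 - q.1) / n) * q.2) := by
  fun_prop

instance isProbabilityMeasure_perturbedLaw (μ : Measure ℝ) [IsProbabilityMeasure μ] (n : ℕ) :
    IsProbabilityMeasure (perturbedLaw μ n) :=
  Measure.isProbabilityMeasure_map (measurable_perturbation n).aemeasurable

theorem mul_one_sub_div_le_one (x : ℝ) {n : ℕ} (hn : 1 ≤ n) : x * (1 - x) / n ≤ 1 := by
  have hn' : (1 : ℝ) ≤ n := by exact_mod_cast hn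
  rw [div_le_one (by linarith)]
  nlinarith [sq_nonneg (x - 1 / 2)]

theorem integrable_id_perturbedLaw {μ : Measure ℝ} [IsProbabilityMeasure μ]
    (hμ : Integrable id μ) {n : ℕ} (hn : 1 ≤ n) : Integrable id (perturbedLaw μ n) := by
  rw [perturbedLaw, integrable_map_measure (by fun_prop) (measurable_perturbation n).aemeasurable]
  have hZ : Integrable id (gaussianReal 0 1) :=
    memLp_one_iff_integrable.1 (memLp_id_gaussianReal 1)
  refine ((hμ.abs.comp_fst _).add (hZ.abs.comp_snd _)).mono'
    (measurable_perturbation n).aestronglyMeasurable (Filter.Eventually.of_forall fun q => ?_)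
  have hs := Real.sqrt_le_one.2 (mul_one_sub_div_le_one q.1 hn)
  calc |q.1 + Real.sqrt (q.1 * (1 - q.1) / n) * q.2|
      ≤ |q.1| + |Real.sqrt (q.1 * (1 - q.1) / n) * q.2| := abs_add_le _ _
    _ ≤ |q.1| + |q.2| := by
      rw [abs_mul, abs_of_nonneg (Real.sqrt_nonneg _)]
      gcongr
      exact mul_le_of_le_one_left (abs_nonneg _) hs

theorem integral_cos_perturbedLaw (μ : Measure ℝ) [IsProbabilityMeasure μ] (n : ℕ) :
    ∫ x, Real.cos x ∂perturbedLaw μ n =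
      ∫ x, Real.cos x * Real.exp (-(Real.sqrt (x * (1 - x) / n) ^ 2 / 2)) ∂μ := by
  rw [perturbedLaw, integral_map (measurable_perturbation n).aemeasurable (by fun_prop),
    integral_prod]
  · simp_rw [integral_cos_add_mul_gaussianReal]
  · exact (integrable_const (1 : ℝ)).mono'
      (Real.continuous_cos.measurable.comp (measurable_perturbation n)).aestronglyMeasurable
      (Filter.Eventually.of_forall fun q => Real.abs_cos_le_one _)

theorem half_le_one_sub_exp_neg {u : ℝ} (h₀ : 0 ≤ u) (h₁ : u ≤ 1) :
    u / 2 ≤ 1 - Real.exp (-u) := by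
  have hexp : (u + 1) * Real.exp (-u) ≤ 1 := by
    calc (u + 1) * Real.exp (-u) ≤ Real.exp u * Real.exp (-u) := by
          gcongr; exact Real.add_one_le_exp u
      _ = 1 := by rw [← Real.exp_add]; simp
  nlinarith [Real.exp_pos (-u)]

/-- If `μ({0,1}) = 0` then `d_W(θ + √(θ(1-θ)/n)Z, θ) ≥ C/n` for some `C > 0`. -/
theorem stmt_16 (μ : Measure ℝ) [IsProbabilityMeasure μ]
    (hsupp : μ (Set.Icc (0 : ℝ) 1)ᶜ = 0) (h01 : μ ({0, 1} : Set ℝ) = 0) :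
    ∃ C : ℝ, 0 < C ∧ ∀ n : ℕ, 1 ≤ n → C / n ≤ dW (perturbedLaw μ n) μ := by
  have hIcc : ∀ᵐ x ∂μ, x ∈ Icc (0 : ℝ) 1 := mem_ae_iff.2 hsupp
  have hne : ∀ᵐ x ∂μ, x ∉ ({0, 1} : Set ℝ) := measure_eq_zero_iff_ae_notMem.1 h01
  have hid : Integrable id μ := by
    refine (integrable_const (1 : ℝ)).mono' (by fun_prop) ?_
    filter_upwards [hIcc] with x hx
    exact abs_le.2 ⟨by simp only [id]; linarith [hx.1], hx.2⟩
  have hvar : Integrable (fun x : ℝ => x * (1 - x)) μ := by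
    refine (integrable_const (1 : ℝ)).mono' (by fun_prop) ?_
    filter_upwards [hIcc] with x hx
    exact abs_le.2 ⟨by nlinarith [hx.1, hx.2], by nlinarith [hx.1, hx.2]⟩
  have hpos : ∀ᵐ x ∂μ, 0 < x * (1 - x) := by
    filter_upwards [hIcc, hne] with x hx hx'
    simp only [mem_insert_iff, mem_singleton_iff, not_or] at hx'
    exact mul_pos (lt_of_le_of_ne hx.1 (Ne.symm hx'.1))
      (sub_pos.2 (lt_of_le_of_ne hx.2 hx'.2))
  have hmean : 0 < ∫ x, x * (1 - x) ∂μ := by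
    have hnonneg : 0 ≤ᵐ[μ] fun x : ℝ => x * (1 - x) := hpos.mono fun _ h => h.le
    refine lt_of_le_of_ne (integral_nonneg_of_ae hnonneg) fun h => ?_
    have hzero := (integral_eq_zero_iff_of_nonneg_ae hnonneg hvar).1 h.symm
    obtain ⟨x, hx, hx'⟩ := (hpos.and hzero).exists
    exact hx.ne' hx'
  refine ⟨Real.cos 1 / 4 * ∫ x, x * (1 - x) ∂μ,
    mul_pos (div_pos Real.cos_one_pos (by norm_num)) hmean, fun n hn => ?_⟩
  have hlip : LipschitzWith 1 Real.cos := Real.lipschitzWith_cos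
  refine le_trans ?_ (abs_integral_sub_integral_le_dW (integrable_id_perturbedLaw hid hn) hid hlip)
  rw [abs_sub_comm]
  refine le_trans ?_ (le_abs_self _)
  have hcos : Integrable Real.cos μ :=
    (integrable_const (1 : ℝ)).mono' (by fun_prop)
      (Filter.Eventually.of_forall Real.abs_cos_le_one)
  have hdamped : Integrable
      (fun x => Real.cos x * Real.exp (-(Real.sqrt (x * (1 - x) / n) ^ 2 / 2))) μ := by
    refine (integrable_const (1 : ℝ)).mono' (by fun_prop) (Filter.Eventually.of_forall fun x => ?_)
    rw [Real.norm_eq_abs, abs_mul, Real.abs_exp]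
    exact mul_le_one₀ (Real.abs_cos_le_one x) (Real.exp_pos _).le
      (Real.exp_le_one_iff.2 (by simp only [neg_nonpos]; positivity))
  rw [integral_cos_perturbedLaw, ← integral_sub hcos hdamped, mul_div_right_comm,
    ← integral_const_mul]
  refine integral_mono_ae (hvar.const_mul _) (hcos.sub hdamped) ?_
  filter_upwards [hIcc, hpos] with x hx hx'
  have hs : 0 ≤ x * (1 - x) / n := by positivity
  have hs' := mul_one_sub_div_le_one x hn
  have hcosx : Real.cos 1 ≤ Real.cos x :=
    Real.cos_le_cos_of_nonneg_of_le_pi hx.1 (by linarith [Real.pi_gt_three]) hx.2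
  rw [Real.sq_sqrt hs]
  have hgap := half_le_one_sub_exp_neg (u := x * (1 - x) / n / 2) (by linarith) (by linarith)
  calc Real.cos 1 / 4 / n * (x * (1 - x)) = Real.cos 1 * (x * (1 - x) / n / 2 / 2) := by ring
    _ ≤ Real.cos x * (1 - Real.exp (-(x * (1 - x) / n / 2))) :=
      mul_le_mul hcosx hgap (by positivity) (Real.cos_one_pos.le.trans hcosx)
    _ = _ := by ring
end
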